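/- arXiv:2601.22521 — 3 statements merged into one kernel-verified Lean document; each statement's English description precedes it below -/
import Mathlib

section
/- Let n be a positive integer, let z_1, ..., z_n be real numbers, and let p > 0. Define w_t = exp(p z_t) / ∑_{j=1}^n exp(p z_j) and q_t = w_t^2 / ∑_{j=1}^n w_j^2. Then q_t = exp(2p z_t) / ∑_{j=1}^n exp(2p z_j) for every t, and ∑_{t=1}^n q_t z_t ≥ ∑_{t=1}^n w_t z_t, with equality if and only if all the z_t are equal. -/
open Finset

/-- The softmax weights with inverse temperature `p`. -/
noncomputable def softmaxW (n : ℕ) (z : Fin n → ℝ) (p : ℝ) (t : Fin n) : ℝ :=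
  Real.exp (p * z t) / ∑ j, Real.exp (p * z j)

/-- The "squared" distribution `qₜ = wₜ² / ∑ⱼ wⱼ²` induced by the softmax weights. -/
noncomputable def sqDist (n : ℕ) (z : Fin n → ℝ) (p : ℝ) (t : Fin n) : ℝ :=
  softmaxW n z p t ^ 2 / ∑ j, softmaxW n z p j ^ 2

/-- Chebyshev-type identity: the gap between the means under squared and plain weights, with
denominators cleared, as a symmetric double sum. -/
theorem two_mul_sum_mul_sum_sq_sub {ι : Type*} [Fintype ι] (a z : ι → ℝ) :
    2 * ((∑ t, a t) * ∑ t, a t ^ 2 * z t - (∑ t, a t ^ 2) * ∑ t, a t * z t) =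
      ∑ s, ∑ t, a s * a t * ((a t - a s) * (z t - z s)) := by
  have h₁ : (∑ t, a t) * ∑ t, a t ^ 2 * z t - (∑ t, a t ^ 2) * ∑ t, a t * z t =
      ∑ s, ∑ t, a s * a t * ((a t - a s) * z t) := by
    simp_rw [Finset.sum_mul_sum, ← Finset.sum_sub_distrib]
    exact Finset.sum_congr rfl fun s _ => Finset.sum_congr rfl fun t _ => by ring
  have h₂ := h₁.trans Finset.sum_comm
  rw [two_mul]
  nth_rw 1 [h₁]
  rw [h₂]
  simp_rw [← Finset.sum_add_distrib]
  exact Finset.sum_congr rfl fun s _ => Finset.sum_congr rfl fun t _ => by ring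

theorem sub_exp_mul_sub_nonneg {p : ℝ} (hp : 0 < p) (x y : ℝ) :
    0 ≤ (Real.exp (p * y) - Real.exp (p * x)) * (y - x) := by
  rcases le_total x y with h | h
  · exact mul_nonneg (sub_nonneg.2 (by gcongr)) (sub_nonneg.2 h)
  · exact mul_nonneg_of_nonpos_of_nonpos (sub_nonpos.2 (by gcongr)) (sub_nonpos.2 h)

theorem sub_exp_mul_sub_eq_zero {p : ℝ} (hp : 0 < p) {x y : ℝ} :
    (Real.exp (p * y) - Real.exp (p * x)) * (y - x) = 0 ↔ x = y := by
  rw [mul_eq_zero, sub_eq_zero, sub_eq_zero, Real.exp_eq_exp, mul_right_inj' hp.ne', or_self,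
    eq_comm]

theorem sqDist_eq (n : ℕ) (z : Fin n → ℝ) (p : ℝ) (t : Fin n) :
    sqDist n z p t = Real.exp (p * z t) ^ 2 / ∑ j, Real.exp (p * z j) ^ 2 := by
  have hA : 0 < ∑ j, Real.exp (p * z j) :=
    Finset.sum_pos (fun _ _ => Real.exp_pos _) ⟨t, Finset.mem_univ t⟩
  simp_rw [sqDist, softmaxW, div_pow, ← Finset.sum_div]
  exact div_div_div_cancel_right₀ (pow_pos hA 2).ne' _ _

/-- The squared distribution `q` of a softmax with inverse temperature `p > 0` is the
softmax with inverse temperature `2p`, and its weighted mean of the `zₜ` dominates the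
softmax-weighted mean, with equality iff all the `zₜ` are equal. -/
theorem sqDist_eq_and_mean_ge (n : ℕ) (hn : 0 < n) (z : Fin n → ℝ) (p : ℝ) (hp : 0 < p) :
    (∀ t, sqDist n z p t = Real.exp (2 * p * z t) / ∑ j, Real.exp (2 * p * z j)) ∧
    (∑ t, softmaxW n z p t * z t ≤ ∑ t, sqDist n z p t * z t) ∧
    ((∑ t, sqDist n z p t * z t = ∑ t, softmaxW n z p t * z t) ↔ ∀ s t, z s = z t) := by
  have : Nonempty (Fin n) := ⟨⟨0, hn⟩⟩
  have hA : 0 < ∑ j, Real.exp (p * z j) :=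
    Finset.sum_pos (fun _ _ => Real.exp_pos _) Finset.univ_nonempty
  have hB : 0 < ∑ j, Real.exp (p * z j) ^ 2 :=
    Finset.sum_pos (fun _ _ => pow_pos (Real.exp_pos _) 2) Finset.univ_nonempty
  have hw : ∑ t, softmaxW n z p t * z t =
      (∑ t, Real.exp (p * z t) * z t) / ∑ j, Real.exp (p * z j) := by
    simp_rw [softmaxW, div_mul_eq_mul_div, Finset.sum_div]
  have hq : ∑ t, sqDist n z p t * z t =
      (∑ t, Real.exp (p * z t) ^ 2 * z t) / ∑ j, Real.exp (p * z j) ^ 2 := by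
    simp_rw [sqDist_eq, div_mul_eq_mul_div, Finset.sum_div]
  have key := two_mul_sum_mul_sum_sq_sub (fun t => Real.exp (p * z t)) z
  have hterm : ∀ s t, 0 ≤ Real.exp (p * z s) * Real.exp (p * z t) *
      ((Real.exp (p * z t) - Real.exp (p * z s)) * (z t - z s)) := fun s t =>
    mul_nonneg (by positivity) (sub_exp_mul_sub_nonneg hp _ _)
  have hnn := Finset.sum_nonneg fun s (_ : s ∈ Finset.univ) =>
    Finset.sum_nonneg fun t (_ : t ∈ Finset.univ) => hterm s t
  refine ⟨fun t => ?_, ?_, ?_⟩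
  · simp_rw [sqDist_eq, ← Real.exp_nat_mul, Nat.cast_ofNat, mul_assoc]
  · rw [hw, hq, div_le_div_iff₀ hA hB]
    linarith
  · have hiff : (∑ t, sqDist n z p t * z t = ∑ t, softmaxW n z p t * z t) ↔
        ∑ s, ∑ t, Real.exp (p * z s) * Real.exp (p * z t) *
          ((Real.exp (p * z t) - Real.exp (p * z s)) * (z t - z s)) = 0 := by
      rw [hw, hq, div_eq_div_iff hB.ne' hA.ne']
      constructor <;> intro h <;> linarith
    rw [hiff, Finset.sum_eq_zero_iff_of_nonneg
      fun s _ => Finset.sum_nonneg fun t _ => hterm s t]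
    simp only [Finset.mem_univ, true_imp_iff]
    refine forall_congr' fun s => ?_
    rw [Finset.sum_eq_zero_iff_of_nonneg fun t _ => hterm s t]
    simp only [Finset.mem_univ, true_imp_iff]
    refine forall_congr' fun t => ?_
    rw [mul_eq_zero_iff_left (by positivity), sub_exp_mul_sub_eq_zero hp]
end

section
/- Let n be a positive integer and let z_1, ..., z_n be real numbers, not all equal. For p ≥ 0 define w_t(p) = exp(p z_t) / ∑_{j=1}^n exp(p z_j) and S(p) = ∑_{t=1}^n w_t(p)^2. Then S is strictly increasing on [0, ∞). If instead all z_t are equal, then S(p) = 1/n for every p. -/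
open Finset

/-- The sum of squared softmax weights. -/
noncomputable def sqWeightSum (n : ℕ) (z : Fin n → ℝ) (p : ℝ) : ℝ :=
  ∑ t, softmaxW n z p t ^ 2

theorem softmaxW_sum_eq_one {n : ℕ} (hn : 0 < n) (z : Fin n → ℝ) (p : ℝ) :
    ∑ t, softmaxW n z p t = 1 := by
  have : Nonempty (Fin n) := ⟨⟨0, hn⟩⟩
  have hZ : 0 < ∑ j, Real.exp (p * z j) :=
    Finset.sum_pos (fun _ _ => Real.exp_pos _) Finset.univ_nonempty
  simp only [softmaxW]
  rw [← Finset.sum_div, div_self hZ.ne']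

theorem softmaxW_le_of_le {n : ℕ} (z : Fin n → ℝ) {p : ℝ} (hp : 0 ≤ p) {s t : Fin n}
    (h : z s ≤ z t) : softmaxW n z p s ≤ softmaxW n z p t := by
  unfold softmaxW
  gcongr

/-- The likelihood ratio of softmax weights is strictly monotone in the score. -/
theorem softmaxW_cross_lt {n : ℕ} (z : Fin n → ℝ) {p q : ℝ} (hpq : p < q) {s t : Fin n}
    (h : z s < z t) :
    softmaxW n z q s * softmaxW n z p t < softmaxW n z p s * softmaxW n z q t := by
  have hZ (r : ℝ) : 0 < ∑ j, Real.exp (r * z j) :=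
    Finset.sum_pos (fun _ _ => Real.exp_pos _) ⟨s, Finset.mem_univ s⟩
  unfold softmaxW
  rw [div_mul_div_comm, div_mul_div_comm, mul_comm (∑ j, Real.exp (p * z j))]
  refine div_lt_div_of_pos_right ?_ (mul_pos (hZ q) (hZ p))
  rw [← Real.exp_add, ← Real.exp_add, Real.exp_lt_exp]
  nlinarith [mul_pos (sub_pos.2 hpq) (sub_pos.2 h)]

theorem softmaxW_cross_nonneg {n : ℕ} (z : Fin n → ℝ) {p q : ℝ} (hp : 0 ≤ p) (hpq : p < q)
    (s t : Fin n) :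
    0 ≤ (softmaxW n z p s - softmaxW n z p t) *
      (softmaxW n z q s * softmaxW n z p t - softmaxW n z p s * softmaxW n z q t) := by
  rcases lt_trichotomy (z s) (z t) with h | h | h
  · exact mul_nonneg_of_nonpos_of_nonpos (sub_nonpos.2 (softmaxW_le_of_le z hp h.le))
      (sub_nonpos.2 (softmaxW_cross_lt z hpq h).le)
  · simp [softmaxW, h]
  · refine mul_nonneg (sub_nonneg.2 (softmaxW_le_of_le z hp h.le)) (sub_nonneg.2 ?_)
    linarith [softmaxW_cross_lt z hpq h]

/-- A Chebyshev-type inequality between softmax weights at two inverse temperatures. -/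
theorem sum_sq_softmaxW_le_sum_mul {n : ℕ} (hn : 0 < n) (z : Fin n → ℝ) {p q : ℝ}
    (hp : 0 ≤ p) (hpq : p < q) :
    ∑ t, softmaxW n z p t ^ 2 ≤ ∑ t, softmaxW n z p t * softmaxW n z q t := by
  have key : 0 ≤ ∑ s, ∑ t, (softmaxW n z p s - softmaxW n z p t) *
      (softmaxW n z q s * softmaxW n z p t - softmaxW n z p s * softmaxW n z q t) :=
    Finset.sum_nonneg fun s _ => Finset.sum_nonneg fun t _ => softmaxW_cross_nonneg z hp hpq s t
  have hu := softmaxW_sum_eq_one hn z p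
  have hv := softmaxW_sum_eq_one hn z q
  generalize softmaxW n z p = u at *
  generalize softmaxW n z q = v at *
  have expand (s t : Fin n) : (u s - u t) * (v s * u t - u s * v t) =
      u s * v s * u t - u s ^ 2 * v t - v s * u t ^ 2 + u s * (u t * v t) := by ring
  simp only [expand, Finset.sum_add_distrib, Finset.sum_sub_distrib, ← Finset.mul_sum,
    ← Finset.sum_mul, hu, hv] at key
  linarith

/-- If the `zₜ` are not all equal, the sum of squared softmax weights
`S(p) = ∑ₜ wₜ(p)²` is strictly increasing on `[0, ∞)`; if all the `zₜ` are equal,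
then `S(p) = 1/n` for every `p`. -/
theorem sqWeightSum_strictMonoOn (n : ℕ) (hn : 0 < n) (z : Fin n → ℝ) :
    ((¬ ∀ s t, z s = z t) → StrictMonoOn (sqWeightSum n z) (Set.Ici 0)) ∧
    ((∀ s t, z s = z t) → ∀ p : ℝ, sqWeightSum n z p = 1 / (n : ℝ)) := by
  refine ⟨fun hz p hp q _ hpq => ?_, fun hz p => ?_⟩
  · have hcheb := sum_sq_softmaxW_le_sum_mul hn z hp hpq
    have hdist : 0 < ∑ t, (softmaxW n z q t - softmaxW n z p t) ^ 2 := by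
      refine (Finset.sum_nonneg fun t _ => sq_nonneg _).lt_of_ne' fun h0 => hz fun s t => ?_
      have heq (i : Fin n) : softmaxW n z q i = softmaxW n z p i := by
        have := (Finset.sum_eq_zero_iff_of_nonneg fun t _ => sq_nonneg _).1 h0 i
          (Finset.mem_univ i)
        exact sub_eq_zero.1 (pow_eq_zero_iff two_ne_zero |>.1 this)
      by_contra hst
      rcases lt_or_gt_of_ne hst with h | h <;>
        simpa [heq] using softmaxW_cross_lt z hpq h
    simp only [sub_sq, Finset.sum_add_distrib, Finset.sum_sub_distrib, mul_assoc,
      ← Finset.mul_sum, mul_comm (softmaxW n z q _)] at hdist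
    unfold sqWeightSum
    linarith
  · have hn' : (n : ℝ) ≠ 0 := by positivity
    have hw (t : Fin n) : softmaxW n z p t = 1 / n := by
      simp [softmaxW, hz _ t, mul_comm (n : ℝ), ← div_div]
    simp only [sqWeightSum, hw, Finset.sum_const, Finset.card_univ, Fintype.card_fin,
      nsmul_eq_mul]
    field_simp
end

section
/- Let n be a positive integer and let z_1, ..., z_n be real numbers. For p ≥ 0 define w_t(p) = exp(p z_t) / ∑_{j=1}^n exp(p z_j) and ESS_norm(p) = (1/n) / ∑_{t=1}^n w_t(p)^2. Then ESS_norm is nonincreasing on [0, ∞), and it is strictly decreasing on [0, ∞) unless all the z_t are equal (in which case ESS_norm(p) = 1 for all p). -/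
open Finset

/-- The normalized effective sample size of the softmax weights. -/
noncomputable def essNorm (n : ℕ) (z : Fin n → ℝ) (p : ℝ) : ℝ :=
  (1 / (n : ℝ)) / ∑ t, softmaxW n z p t ^ 2

/-- The partition function of a finite family of energies. -/
noncomputable def expSum {ι : Type*} [Fintype ι] (z : ι → ℝ) (p : ℝ) : ℝ :=
  ∑ i, Real.exp (p * z i)

section expSum

variable {ι : Type*} [Fintype ι] (z : ι → ℝ)

lemma expSum_pos [Nonempty ι] (p : ℝ) : 0 < expSum z p :=
  sum_pos (fun _ _ => Real.exp_pos _) univ_nonempty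

lemma two_mul_expSum_mul_sub (p c d : ℝ) :
    2 * (expSum z p * expSum z (p + c + d) - expSum z (p + c) * expSum z (p + d)) =
      ∑ i, ∑ j, Real.exp (p * z i) * Real.exp (p * z j) *
        ((Real.exp (c * z i) - Real.exp (c * z j)) *
          (Real.exp (d * z i) - Real.exp (d * z j))) := by
  have h₁ : expSum z p * expSum z (p + c + d) =
      ∑ i, ∑ j, Real.exp (p * z i) * Real.exp ((p + c + d) * z j) := sum_mul_sum ..
  have h₂ : expSum z (p + c) * expSum z (p + d) =
      ∑ i, ∑ j, Real.exp ((p + c) * z i) * Real.exp ((p + d) * z j) := sum_mul_sum ..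
  have h₁' := h₁.trans sum_comm
  have h₂' := h₂.trans sum_comm
  rw [two_mul]
  nth_rewrite 1 [h₁, h₂]
  rw [h₁', h₂']
  simp only [← sum_sub_distrib, ← sum_add_distrib]
  refine sum_congr rfl fun i _ => sum_congr rfl fun j _ => ?_
  simp only [add_mul, Real.exp_add]
  ring

lemma exp_sub_mul_exp_sub_nonneg {c d : ℝ} (hc : 0 ≤ c) (hd : 0 ≤ d) (x y : ℝ) :
    0 ≤ (Real.exp (c * x) - Real.exp (c * y)) * (Real.exp (d * x) - Real.exp (d * y)) := by
  rcases le_total x y with h | h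
  · apply mul_nonneg_of_nonpos_of_nonpos <;> rw [sub_nonpos] <;> gcongr
  · apply mul_nonneg <;> rw [sub_nonneg] <;> gcongr

lemma exp_sub_mul_exp_sub_pos {c d : ℝ} (hc : 0 < c) (hd : 0 < d) {x y : ℝ} (hxy : x ≠ y) :
    0 < (Real.exp (c * x) - Real.exp (c * y)) * (Real.exp (d * x) - Real.exp (d * y)) := by
  rcases hxy.lt_or_gt with h | h
  · apply mul_pos_of_neg_of_neg <;> rw [sub_neg] <;> gcongr
  · apply mul_pos <;> rw [sub_pos] <;> gcongr

lemma expSum_mul_le (p : ℝ) {c d : ℝ} (hc : 0 ≤ c) (hd : 0 ≤ d) :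
    expSum z (p + c) * expSum z (p + d) ≤ expSum z p * expSum z (p + c + d) := by
  have h : 0 ≤ 2 * (expSum z p * expSum z (p + c + d) - expSum z (p + c) * expSum z (p + d)) := by
    rw [two_mul_expSum_mul_sub]
    exact sum_nonneg fun i _ => sum_nonneg fun j _ =>
      mul_nonneg (by positivity) (exp_sub_mul_exp_sub_nonneg hc hd _ _)
  linarith

lemma expSum_mul_lt (p : ℝ) {c d : ℝ} (hc : 0 < c) (hd : 0 < d) (hz : ∃ s t, z s ≠ z t) :
    expSum z (p + c) * expSum z (p + d) < expSum z p * expSum z (p + c + d) := by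
  obtain ⟨s, t, hst⟩ := hz
  have hnonneg (i j : ι) : 0 ≤ Real.exp (p * z i) * Real.exp (p * z j) *
      ((Real.exp (c * z i) - Real.exp (c * z j)) * (Real.exp (d * z i) - Real.exp (d * z j))) :=
    mul_nonneg (by positivity) (exp_sub_mul_exp_sub_nonneg hc.le hd.le _ _)
  have h : 0 < 2 * (expSum z p * expSum z (p + c + d) - expSum z (p + c) * expSum z (p + d)) := by
    rw [two_mul_expSum_mul_sub]
    exact sum_pos' (fun i _ => sum_nonneg fun j _ => hnonneg i j)
      ⟨s, mem_univ s, sum_pos' (fun j _ => hnonneg s j)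
        ⟨t, mem_univ t, mul_pos (by positivity) (exp_sub_mul_exp_sub_pos hc hd hst)⟩⟩
  linarith

lemma expSum_sq_div_lt [Nonempty ι] (hz : ∃ s t, z s ≠ z t) {p q : ℝ} (hp : 0 ≤ p)
    (hpq : p < q) :
    expSum z q ^ 2 / expSum z (2 * q) < expSum z p ^ 2 / expSum z (2 * p) := by
  have h₁ := expSum_mul_le z p (sub_nonneg.2 hpq.le) hp
  have h₂ := expSum_mul_lt z p (sub_pos.2 hpq) (hp.trans_lt hpq) hz
  rw [add_sub_cancel, ← two_mul, add_comm q p] at h₁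
  rw [add_sub_cancel, ← two_mul] at h₂
  rw [div_lt_div_iff₀ (expSum_pos z _) (expSum_pos z _)]
  calc expSum z q ^ 2 * expSum z (2 * p)
      = expSum z q * (expSum z q * expSum z (2 * p)) := by ring
    _ ≤ expSum z q * (expSum z p * expSum z (p + q)) :=
        mul_le_mul_of_nonneg_left h₁ (expSum_pos z q).le
    _ = expSum z p * (expSum z q * expSum z (p + q)) := by ring
    _ < expSum z p * (expSum z p * expSum z (2 * q)) :=
        mul_lt_mul_of_pos_left h₂ (expSum_pos z p)
    _ = expSum z p ^ 2 * expSum z (2 * q) := by ring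

end expSum

lemma essNorm_eq (n : ℕ) (z : Fin n → ℝ) (p : ℝ) :
    essNorm n z p = 1 / n * (expSum z p ^ 2 / expSum z (2 * p)) := by
  have h : ∑ t, softmaxW n z p t ^ 2 = expSum z (2 * p) / expSum z p ^ 2 := by
    rw [expSum, sum_div]
    refine sum_congr rfl fun t _ => ?_
    rw [softmaxW, div_pow, ← Real.exp_nat_mul, Nat.cast_ofNat, mul_assoc]
    rfl
  rw [essNorm, h, div_eq_mul_inv, inv_div]

lemma essNorm_strictAntiOn {n : ℕ} (hn : 0 < n) (z : Fin n → ℝ) (hz : ¬ ∀ s t, z s = z t) :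
    StrictAntiOn (essNorm n z) (Set.Ici 0) := by
  intro p hp q _ hpq
  have : Nonempty (Fin n) := ⟨⟨0, hn⟩⟩
  rw [essNorm_eq, essNorm_eq]
  push Not at hz
  exact mul_lt_mul_of_pos_left (expSum_sq_div_lt z hz hp hpq) (by positivity)

lemma essNorm_eq_one {n : ℕ} (hn : 0 < n) (z : Fin n → ℝ) (hz : ∀ s t, z s = z t) (p : ℝ) :
    essNorm n z p = 1 := by
  have h (r : ℝ) : expSum z r = n * Real.exp (r * z ⟨0, hn⟩) := by
    simp [expSum, fun s => hz s ⟨0, hn⟩]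
  rw [essNorm_eq, h, h, mul_assoc 2, two_mul, Real.exp_add]
  field_simp

/-- The normalized effective sample size `ESS_norm(p)` of the softmax weights is
nonincreasing on `[0, ∞)`; it is strictly decreasing on `[0, ∞)` unless all the `zₜ`
are equal, in which case `ESS_norm(p) = 1` for all `p`. -/
theorem essNorm_antitoneOn (n : ℕ) (hn : 0 < n) (z : Fin n → ℝ) :
    AntitoneOn (essNorm n z) (Set.Ici 0) ∧
    ((¬ ∀ s t, z s = z t) → StrictAntiOn (essNorm n z) (Set.Ici 0)) ∧
    ((∀ s t, z s = z t) → ∀ p : ℝ, essNorm n z p = 1) := by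
  refine ⟨?_, essNorm_strictAntiOn hn z, essNorm_eq_one hn z⟩
  by_cases hz : ∀ s t, z s = z t
  · intro p _ q _ _
    rw [essNorm_eq_one hn z hz, essNorm_eq_one hn z hz]
  · exact (essNorm_strictAntiOn hn z hz).antitoneOn
end
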